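/- Let h ∈ F_q[x] satisfy gcd(h(x), (x^n − 1)/(x − 1)) = 1 in F_q[x], and let m be a positive integer with 1 < m < q − 1 and gcd(m, q − 1) = 1. Then for every α, β, θ_0, ..., θ_{q−1} ∈ F_{q^n} such that Tr_{q^n/q}(α) = −h(1) and Tr_{q^n/q}(β) ≠ 0, the polynomial P(x) = L_h(x) + α·Tr_{q^n/q}(x) + β·Tr_{q^n/q}(x)^m + Σ_{i=0}^{q−1} (θ_i^q − θ_i)·Tr_{q^n/q}(x)^i is a permutation polynomial of F_{q^n}. -/

import Mathlib

open Polynomial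

/-- The linearized `q`-associate of `f ∈ 𝔽_q[x]`, evaluated on an extension field:
`L_f(y) = Σ aᵢ y^(qⁱ)` where `q` is the cardinality of `Fq`. -/
noncomputable def Lq {Fq Fqn : Type*} [Field Fq] [Fintype Fq] [Field Fqn] [Algebra Fq Fqn]
    (f : Polynomial Fq) (y : Fqn) : Fqn :=
  f.sum fun i a => algebraMap Fq Fqn a * y ^ (Fintype.card Fq) ^ i

/-- `T_n[f](x) = Σ Tr(aᵢ) xⁱ ∈ 𝔽_q[x]` for `f = Σ aᵢ xⁱ ∈ 𝔽_{qⁿ}[x]`, where `Tr` is the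
field trace from `𝔽_{qⁿ}` onto `𝔽_q`. -/
noncomputable def Tn (Fq : Type*) {Fqn : Type*} [Field Fq] [Field Fqn] [Algebra Fq Fqn]
    (f : Polynomial Fqn) : Polynomial Fq :=
  f.sum fun i a => C (Algebra.trace Fq Fqn a) * X ^ i

section LinearizedAssociate

variable {Fq Fqn : Type*} [Field Fq] [Fintype Fq] [Field Fqn] [Algebra Fq Fqn]

theorem Lq_eq_aeval_frobenius (f : Fq[X]) (y : Fqn) :
    Lq f y = aeval (FiniteField.frobeniusAlgHom Fq Fqn).toLinearMap f y := by
  have hpow (i : ℕ) : ((FiniteField.frobeniusAlgHom Fq Fqn).toLinearMap ^ i) y =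
      y ^ Fintype.card Fq ^ i := by
    rw [Module.End.pow_apply, AlgHom.coe_toLinearMap, FiniteField.coe_frobeniusAlgHom, pow_iterate]
  simp only [Lq, aeval_eq_sum_range, LinearMap.sum_apply, LinearMap.smul_apply, hpow,
    ← Algebra.smul_def]
  exact sum_over_range f fun i => zero_smul Fq _

theorem Lq_sub (f : Fq[X]) (x y : Fqn) : Lq f (x - y) = Lq f x - Lq f y := by
  simp only [Lq_eq_aeval_frobenius, map_sub]

theorem trace_pow_card_pow [FiniteDimensional Fq Fqn] (y : Fqn) (i : ℕ) :
    Algebra.trace Fq Fqn (y ^ Fintype.card Fq ^ i) = Algebra.trace Fq Fqn y := by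
  induction i with
  | zero => simp
  | succ i ih =>
    rw [pow_succ, pow_mul, ← ih]
    exact Algebra.trace_eq_of_algEquiv
      (FiniteField.frobeniusAlgEquivOfAlgebraic Fq Fqn) (y ^ Fintype.card Fq ^ i)

theorem trace_Lq [FiniteDimensional Fq Fqn] (f : Fq[X]) (y : Fqn) :
    Algebra.trace Fq Fqn (Lq f y) = f.eval 1 * Algebra.trace Fq Fqn y := by
  simp only [Lq, Polynomial.sum, eval_eq_sum, map_sum, ← Algebra.smul_def, map_smul,
    trace_pow_card_pow, smul_eq_mul, one_pow, mul_one, Finset.sum_mul]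

/-- The trace is the linearized associate of `1 + X + ⋯ + X ^ (n - 1)`. -/
theorem Lq_geom_sum [FiniteDimensional Fq Fqn] (y : Fqn) :
    Lq (∑ i ∈ Finset.range (Module.finrank Fq Fqn), (X : Fq[X]) ^ i) y =
      algebraMap Fq Fqn (Algebra.trace Fq Fqn y) := by
  have : Finite Fqn := Module.finite_of_finite Fq
  rw [FiniteField.algebraMap_trace_eq_sum_pow, Lq_eq_aeval_frobenius]
  simp [Module.End.pow_apply, FiniteField.coe_frobeniusAlgHom, pow_iterate]

theorem eq_zero_of_Lq_eq_zero_of_isCoprime {f g : Fq[X]} (hfg : IsCoprime f g) {y : Fqn}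
    (hf : Lq f y = 0) (hg : Lq g y = 0) : y = 0 := by
  obtain ⟨a, b, hab⟩ := hfg
  rw [Lq_eq_aeval_frobenius] at hf hg
  have := congrArg (fun p => aeval (FiniteField.frobeniusAlgHom Fq Fqn).toLinearMap p y) hab
  simpa [hf, hg] using this.symm

theorem X_pow_sub_one_div_X_sub_one {K : Type*} [Field K] (n : ℕ) :
    ((X ^ n - 1) / (X - 1) : K[X]) = ∑ i ∈ Finset.range n, X ^ i := by
  rw [← mul_geom_sum]
  exact mul_div_cancel_left₀ _ (X_sub_C_ne_zero (1 : K))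

theorem pow_injective_of_coprime_card_sub_one {m : ℕ} (hm : m ≠ 0)
    (hcop : m.Coprime (Fintype.card Fq - 1)) : Function.Injective fun x : Fq => x ^ m := by
  classical
  intro x y hxy
  simp only at hxy
  by_cases hx : x = 0
  · subst hx
    rw [zero_pow hm] at hxy
    exact (eq_zero_of_pow_eq_zero hxy.symm).symm
  · have hy : y ≠ 0 := by
      rintro rfl
      exact hx (eq_zero_of_pow_eq_zero (hxy.trans (zero_pow hm)))
    have hc : (Nat.card Fqˣ).Coprime m := by
      rw [Nat.card_eq_fintype_card, Fintype.card_units]; exact hcop.symm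
    have := (powCoprime hc).injective (a₁ := Units.mk0 x hx) (a₂ := Units.mk0 y hy)
      (by ext; simpa using hxy)
    simpa using congrArg Units.val this

end LinearizedAssociate

/-- Let `h ∈ 𝔽_q[x]` with `gcd(h, (xⁿ-1)/(x-1)) = 1`, and `m` with `1 < m < q - 1` and
`gcd(m, q-1) = 1`. For any `α, β, θ₀, …, θ_{q-1} ∈ 𝔽_{qⁿ}` with `Tr(α) = -h(1)` and
`Tr(β) ≠ 0`, the polynomial
`P(x) = L_h(x) + α·Tr(x) + β·Tr(x)^m + Σᵢ (θᵢ^q - θᵢ)·Tr(x)ⁱ` permutes `𝔽_{qⁿ}`. -/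
theorem PP_monomial_construction_deg_m {Fq Fqn : Type*} [Field Fq] [Fintype Fq]
    [DecidableEq Fq] [Field Fqn] [Algebra Fq Fqn]
    {n : ℕ} (hn : 0 < n) (hrank : Module.finrank Fq Fqn = n)
    (h : Polynomial Fq) (hgcd : gcd h ((X ^ n - 1) / (X - 1) : Polynomial Fq) = 1)
    (m : ℕ) (hm1 : 1 < m) (hm2 : m < Fintype.card Fq - 1)
    (hmcop : Nat.gcd m (Fintype.card Fq - 1) = 1)
    (α β : Fqn) (θ : Fin (Fintype.card Fq) → Fqn)
    (hα : Algebra.trace Fq Fqn α = -(h.eval 1))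
    (hβ : Algebra.trace Fq Fqn β ≠ 0) :
    Function.Bijective fun x : Fqn =>
      Lq h x + α * algebraMap Fq Fqn (Algebra.trace Fq Fqn x) +
        β * algebraMap Fq Fqn (Algebra.trace Fq Fqn x) ^ m +
        ∑ i : Fin (Fintype.card Fq),
          (θ i ^ Fintype.card Fq - θ i) *
            algebraMap Fq Fqn (Algebra.trace Fq Fqn x) ^ (i : ℕ) := by
  subst hrank
  have : FiniteDimensional Fq Fqn := FiniteDimensional.of_finrank_pos hn
  have : Finite Fqn := Module.finite_of_finite Fq
  have hcop : IsCoprime h (∑ i ∈ Finset.range (Module.finrank Fq Fqn), X ^ i) := by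
    rw [← X_pow_sub_one_div_X_sub_one, ← gcd_isUnit_iff, hgcd]
    exact isUnit_one
  have trace_mul (a : Fqn) (c : Fq) :
      Algebra.trace Fq Fqn (a * algebraMap Fq Fqn c) = Algebra.trace Fq Fqn a * c := by
    rw [mul_comm, ← Algebra.smul_def, map_smul, smul_eq_mul, mul_comm]
  have trace_theta (a : Fqn) :
      Algebra.trace Fq Fqn (a ^ Fintype.card Fq - a) = 0 := by
    rw [map_sub, ← trace_pow_card_pow a 1, pow_one, sub_self]
  refine Finite.injective_iff_bijective.mp fun x y hxy => ?_
  have htr : Algebra.trace Fq Fqn x = Algebra.trace Fq Fqn y := by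
    have hT := congrArg (Algebra.trace Fq Fqn) hxy
    simp only [map_add, map_sum, ← map_pow, trace_mul, trace_theta, trace_Lq, hα, zero_mul,
      Finset.sum_const_zero, neg_mul, add_neg_cancel, zero_add, add_zero] at hT
    exact pow_injective_of_coprime_card_sub_one (by omega) hmcop (mul_left_cancel₀ hβ hT)
  rw [htr] at hxy
  refine sub_eq_zero.mp (eq_zero_of_Lq_eq_zero_of_isCoprime hcop ?_ ?_)
  · rw [Lq_sub, sub_eq_zero]
    simpa using hxy
  · rw [Lq_geom_sum, map_sub, htr, sub_self, map_zero]
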